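/- Let k be a tensor Markov kernel on (0,1)^d satisfying Assumption SL. There exists a constant C > 0, depending only on k and d, such that for every level τ ≥ 2 and every x ∈ (0,1)^d, with the design being the classical sparse grid X_τ^SG of size m := |X_τ^SG|, kernel matrix K := k(X_τ^SG, X_τ^SG) and vector k(x) := (k(x,z))_{z∈X_τ^SG}: the number of nonzero entries of K^{-1} is at most C·m, and the number of nonzero entries of the vector K^{-1}k(x) is at most C·(log m)^{d−1}. -/

import Mathlib

open Matrix

noncomputable section

/-- The dyadic point `c_{l,i} = i · 2^{-l}`. -/
def cpt (l i : ℕ) : ℝ := (i : ℝ) / 2 ^ l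

/-- The multidimensional dyadic point `c_{l,i}`. -/
def cpoint {d : ℕ} (l i : Fin d → ℕ) : Fin d → ℝ := fun j => cpt (l j) (i j)

/-- The set `ρ(l)` of odd multi-indices associated with the level multi-index `l`. -/
def rho {d : ℕ} (l : Fin d → ℕ) : Set (Fin d → ℕ) :=
  {i | ∀ j, Odd (i j) ∧ 1 ≤ i j ∧ i j ≤ 2 ^ (l j) - 1}

/-- The classical sparse grid of level `τ` in dimension `d`. -/
def SGset (d τ : ℕ) : Set (Fin d → ℝ) :=
  {x | ∃ l : Fin d → ℕ, (∀ j, 1 ≤ l j) ∧ (∑ j, l j) ≤ τ + d - 1 ∧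
    ∀ j, ∃ i : ℕ, 1 ≤ i ∧ i ≤ 2 ^ (l j) - 1 ∧ x j = cpt (l j) i}

/-- A tensor Markov kernel on `(0,1)^d` satisfying Assumption SL: factors
`p_j, q_j` are continuous on `[0,1]`, positive on `(0,1)`, satisfy the strict
"determinant" positivity (the precise form of `p_j/q_j` strictly increasing with
`p_j, q_j > 0`), are continuously differentiable on `(0,1)`, and both solve the
Sturm–Liouville equation `(u_j f')' + v_j f = 0` on `(0,1)`. -/
structure TMKernelSL (d : ℕ) where
  p : Fin d → ℝ → ℝ
  q : Fin d → ℝ → ℝ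
  cont_p : ∀ j, ContinuousOn (p j) (Set.Icc 0 1)
  cont_q : ∀ j, ContinuousOn (q j) (Set.Icc 0 1)
  pos_p : ∀ j, ∀ x ∈ Set.Ioo (0:ℝ) 1, 0 < p j x
  pos_q : ∀ j, ∀ x ∈ Set.Ioo (0:ℝ) 1, 0 < q j x
  det_pos : ∀ j, ∀ y ∈ Set.Icc (0:ℝ) 1, ∀ x ∈ Set.Icc (0:ℝ) 1, y < x →
    0 < p j x * q j y - p j y * q j x
  u : Fin d → ℝ → ℝ
  v : Fin d → ℝ → ℝ
  contDiff_p : ∀ j, ContDiffOn ℝ 1 (p j) (Set.Ioo 0 1)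
  contDiff_q : ∀ j, ContDiffOn ℝ 1 (q j) (Set.Ioo 0 1)
  contDiff_u : ∀ j, ContDiffOn ℝ 1 (u j) (Set.Ioo 0 1)
  cont_v : ∀ j, ContinuousOn (v j) (Set.Ioo 0 1)
  sl_p : ∀ j, ∀ x ∈ Set.Ioo (0:ℝ) 1,
    deriv (fun t => u j t * deriv (p j) t) x + v j x * p j x = 0
  sl_q : ∀ j, ∀ x ∈ Set.Ioo (0:ℝ) 1,
    deriv (fun t => u j t * deriv (q j) t) x + v j x * q j x = 0

/-- The tensor Markov kernel `k(x,x') = ∏_j p_j(min) q_j(max)`. -/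
def TMKernelSL.k {d : ℕ} (κ : TMKernelSL d) (x x' : Fin d → ℝ) : ℝ :=
  ∏ j, κ.p j (min (x j) (x' j)) * κ.q j (max (x j) (x' j))

/-- The `j`-th one-dimensional factor kernel of a TM kernel. -/
def TMKernelSL.k1 {d : ℕ} (κ : TMKernelSL d) (j : Fin d) (a b : ℝ) : ℝ :=
  κ.p j (min a b) * κ.q j (max a b)

/-- Kernel matrix of the design `x_1,…,x_n`. -/
def kerMat {d n : ℕ} (κ : TMKernelSL d) (x : Fin n → Fin d → ℝ) :
    Matrix (Fin n) (Fin n) ℝ :=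
  Matrix.of fun a b => κ.k (x a) (x b)

/-- Kernel vector `k(z) = (k(z,x_1),…,k(z,x_n))`. -/
def kerVec {d n : ℕ} (κ : TMKernelSL d) (x : Fin n → Fin d → ℝ) (z : Fin d → ℝ) :
    Fin n → ℝ :=
  fun a => κ.k z (x a)

/-- `x_1,…,x_n` is a truncated sparse grid design: the points are distinct, and for the level
`τ` with `|X_τ^SG| ≤ n < |X_{τ+1}^SG|`, the design contains all of `X_τ^SG` and is contained
in `X_{τ+1}^SG`. -/
def IsTSGDesign {d n : ℕ} (x : Fin n → Fin d → ℝ) : Prop :=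
  Function.Injective x ∧
  ∃ τ : ℕ, 1 ≤ τ ∧ (SGset d τ).ncard ≤ n ∧ n < (SGset d (τ + 1)).ncard ∧
    SGset d τ ⊆ Set.range x ∧ Set.range x ⊆ SGset d (τ + 1)

/-- One-dimensional quantity `η_{l,i}` (the squared RKHS norm of the hat function). -/
def eta1 (p q : ℝ → ℝ) (l i : ℕ) : ℝ :=
  (p (cpt l (i + 1)) * q (cpt l (i - 1)) - p (cpt l (i - 1)) * q (cpt l (i + 1))) /
    ((p (cpt l i) * q (cpt l (i - 1)) - p (cpt l (i - 1)) * q (cpt l i)) *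
      (p (cpt l (i + 1)) * q (cpt l i) - p (cpt l i) * q (cpt l (i + 1))))

/-- Multidimensional `η_{l,i} = ∏_j η^{(j)}_{l_j,i_j}`. -/
def etaP {d : ℕ} (p q : Fin d → ℝ → ℝ) (l i : Fin d → ℕ) : ℝ :=
  ∏ j, eta1 (p j) (q j) (l j) (i j)

/-- One-dimensional hat function `φ_{l,i}` associated with `p, q`. -/
def phi1 (p q : ℝ → ℝ) (l i : ℕ) (x : ℝ) : ℝ :=
  if cpt l (i - 1) < x ∧ x ≤ cpt l i then
    (p x * q (cpt l (i - 1)) - p (cpt l (i - 1)) * q x) /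
      (p (cpt l i) * q (cpt l (i - 1)) - p (cpt l (i - 1)) * q (cpt l i))
  else if cpt l i < x ∧ x < cpt l (i + 1) then
    (p (cpt l (i + 1)) * q x - p x * q (cpt l (i + 1))) /
      (p (cpt l (i + 1)) * q (cpt l i) - p (cpt l i) * q (cpt l (i + 1)))
  else 0

/-- Multidimensional hat function `φ_{l,i}(x) = ∏_j φ^{(j)}_{l_j,i_j}(x_j)`. -/
def phiD {d : ℕ} (p q : Fin d → ℝ → ℝ) (l i : Fin d → ℕ) (x : Fin d → ℝ) : ℝ :=
  ∏ j, phi1 (p j) (q j) (l j) (i j) (x j)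

/-- The open hyperrectangle `R_{l,i} = ∏_j (c_{l_j,i_j−1}, c_{l_j,i_j+1})`. -/
def hyperRect {d : ℕ} (l i : Fin d → ℕ) : Set (Fin d → ℝ) :=
  {z | ∀ j, cpt (l j) (i j - 1) < z j ∧ z j < cpt (l j) (i j + 1)}

/-- Number of nonzero entries of a real matrix. -/
def nnzM {α β : Type*} [Fintype α] [Fintype β] (M : Matrix α β ℝ) : ℕ :=
  Set.ncard {ab : α × β | M ab.1 ab.2 ≠ 0}

end

/-- The one-dimensional dyadic grid `{i · 2^{-l} : 1 ≤ i ≤ 2^l - 1}`. -/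
noncomputable def dyadicGrid (l : ℕ) : Finset ℝ := (Finset.Icc 1 (2 ^ l - 1)).image (cpt l)

/-- The mesh width of the dyadic grid of level `l`. -/
noncomputable def mesh (l : ℕ) : ℝ := 1 / 2 ^ l

lemma mesh_pos (l : ℕ) : 0 < mesh l := by unfold mesh; positivity

lemma cpt_injective (l : ℕ) : Function.Injective (cpt l) := by
  intro a b hab
  have h2 : (2 : ℝ) ^ l ≠ 0 := by positivity
  simp only [cpt] at hab
  field_simp at hab
  exact_mod_cast hab

lemma mem_dyadicGrid {l : ℕ} {x : ℝ} :
    x ∈ dyadicGrid l ↔ ∃ i : ℕ, 1 ≤ i ∧ i ≤ 2 ^ l - 1 ∧ x = cpt l i := by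
  simp only [dyadicGrid, Finset.mem_image, Finset.mem_Icc]
  constructor
  · rintro ⟨i, ⟨h1, h2⟩, rfl⟩; exact ⟨i, h1, h2, rfl⟩
  · rintro ⟨i, h1, h2, rfl⟩; exact ⟨i, ⟨h1, h2⟩, rfl⟩

lemma dyadicGrid_zero : dyadicGrid 0 = ∅ := by simp [dyadicGrid]

lemma card_dyadicGrid (l : ℕ) : (dyadicGrid l).card = 2 ^ l - 1 := by
  rw [dyadicGrid, Finset.card_image_of_injective _ (cpt_injective l)]
  simp

lemma dyadicGrid_mono : Monotone dyadicGrid := by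
  refine monotone_nat_of_le_succ fun l x hx => ?_
  obtain ⟨i, h1, h2, rfl⟩ := mem_dyadicGrid.1 hx
  refine mem_dyadicGrid.2 ⟨2 * i, by omega, by rw [pow_succ]; omega, ?_⟩
  simp only [cpt]
  push_cast
  rw [pow_succ]
  field_simp

lemma cpt_pred {l i : ℕ} (h : 1 ≤ i) : cpt l i - mesh l = cpt l (i - 1) := by
  simp only [cpt, mesh]
  rw [Nat.cast_sub h]
  push_cast
  ring

lemma cpt_succ (l i : ℕ) : cpt l i + mesh l = cpt l (i + 1) := by
  simp only [cpt, mesh]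
  push_cast
  ring

lemma dyadicGrid_subset_Ioo {l : ℕ} {x : ℝ} (hx : x ∈ dyadicGrid l) : x ∈ Set.Ioo (0 : ℝ) 1 := by
  obtain ⟨i, h1, h2, rfl⟩ := mem_dyadicGrid.1 hx
  have hp : (0 : ℝ) < 2 ^ l := by positivity
  have hi : (1 : ℝ) ≤ i := by exact_mod_cast h1
  have hi2 : i + 1 ≤ 2 ^ l := by have := Nat.one_le_two_pow (n := l); omega
  have hi3 : (i : ℝ) + 1 ≤ 2 ^ l := by exact_mod_cast hi2
  constructor
  · unfold cpt; positivity
  · rw [cpt, div_lt_one hp]; linarith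

lemma dyadicGrid_pred {l : ℕ} {x : ℝ} (hx : x ∈ dyadicGrid l) :
    x - mesh l = 0 ∨ x - mesh l ∈ dyadicGrid l := by
  obtain ⟨i, h1, h2, rfl⟩ := mem_dyadicGrid.1 hx
  rw [cpt_pred h1]
  rcases Nat.lt_or_ge 1 i with h | h
  · exact Or.inr (mem_dyadicGrid.2 ⟨i - 1, by omega, by omega, rfl⟩)
  · left
    have : i - 1 = 0 := by omega
    simp [cpt, this]

lemma dyadicGrid_succ {l : ℕ} {x : ℝ} (hx : x ∈ dyadicGrid l) :
    x + mesh l = 1 ∨ x + mesh l ∈ dyadicGrid l := by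
  obtain ⟨i, h1, h2, rfl⟩ := mem_dyadicGrid.1 hx
  rw [cpt_succ]
  rcases Nat.lt_or_ge i (2 ^ l - 1) with h | h
  · exact Or.inr (mem_dyadicGrid.2 ⟨i + 1, by omega, by omega, rfl⟩)
  · left
    have : i + 1 = 2 ^ l := by omega
    rw [cpt, this]
    push_cast
    exact div_self (by positivity)

lemma dyadicGrid_gap {l : ℕ} {x y : ℝ} (hx : x ∈ dyadicGrid l) (hy : y ∈ dyadicGrid l)
    (h : x < y) : x + mesh l ≤ y := by
  obtain ⟨i, h1, h2, rfl⟩ := mem_dyadicGrid.1 hx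
  obtain ⟨j, h3, h4, rfl⟩ := mem_dyadicGrid.1 hy
  rw [cpt_succ]
  have hp : (0 : ℝ) < 2 ^ l := by positivity
  unfold cpt at *
  rw [div_lt_div_iff_of_pos_right hp] at h
  rw [div_le_div_iff_of_pos_right hp]
  exact_mod_cast h

/-- The points of the dyadic grid of level `l` near a point `z`. -/
noncomputable def nearPts (l : ℕ) (z : ℝ) : Finset ℝ :=
  {cpt l ⌊z * 2 ^ l⌋₊, cpt l (⌊z * 2 ^ l⌋₊ + 1)}

lemma mem_nearPts {l : ℕ} {w z : ℝ} (hz : 0 ≤ z) (hw : w ∈ dyadicGrid l) (h1 : w - mesh l < z)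
    (h2 : z < w + mesh l) : w ∈ nearPts l z := by
  obtain ⟨i, hi1, hi2, rfl⟩ := mem_dyadicGrid.1 hw
  have hp : (0 : ℝ) < 2 ^ l := by positivity
  rw [cpt_pred hi1] at h1
  rw [cpt_succ] at h2
  rw [cpt, div_lt_iff₀ hp] at h1
  rw [cpt, lt_div_iff₀ hp] at h2
  have a1 : i - 1 ≤ ⌊z * 2 ^ l⌋₊ := Nat.le_floor h1.le
  have a2 : ⌊z * 2 ^ l⌋₊ < i + 1 := (Nat.floor_lt (by positivity)).2 h2
  have : i = ⌊z * 2 ^ l⌋₊ ∨ i = ⌊z * 2 ^ l⌋₊ + 1 := by omega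
  simp only [nearPts, Finset.mem_insert, Finset.mem_singleton]
  rcases this with h | h
  · left; rw [← h]
  · right; rw [← h]

/-- The grid point `b` of level `l` together with its two neighbours. -/
noncomputable def nbrs (l : ℕ) (b : ℝ) : Finset ℝ := {b - mesh l, b, b + mesh l}

/-- Sparse inverses of a kernel on all dyadic grids, extended by zero. -/
structure DyadicInverse (k : ℝ → ℝ → ℝ) where
  T : ℕ → ℝ → ℝ → ℝ
  mem_left : ∀ {l w b}, T l w b ≠ 0 → w ∈ dyadicGrid l
  mem_right : ∀ {l w b}, T l w b ≠ 0 → b ∈ dyadicGrid l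
  mem_nbrs : ∀ {l w b}, T l w b ≠ 0 → w ∈ nbrs l b
  mul_eq : ∀ {l a}, a ∈ dyadicGrid l → ∀ b,
    ∑ w ∈ dyadicGrid l, k a w * T l w b = if a = b then 1 else 0
  apply_near : ∀ {z}, z ∈ Set.Ioo (0 : ℝ) 1 → ∀ {l w},
    ∑ b ∈ dyadicGrid l, T l w b * k z b ≠ 0 → w ∈ nearPts l z

section OneDim

variable (P Q : ℝ → ℝ)

/-- The determinant of the vectors `(P, Q)` at two points. -/
def wron (x y : ℝ) : ℝ := P x * Q y - P y * Q x

/-- The tridiagonal inverse of a Markov kernel matrix, before restricting to the grid. -/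
noncomputable def tridiag (h w b : ℝ) : ℝ :=
  if w = b then wron P Q (b + h) (b - h) / (wron P Q b (b - h) * wron P Q (b + h) b)
  else if w = b + h then -1 / wron P Q (b + h) b
  else if w = b - h then -1 / wron P Q b (b - h)
  else 0

open Classical in
/-- The inverse of a Markov kernel matrix on the dyadic grid of level `l`, extended by zero. -/
noncomputable def markovInv (l : ℕ) (w b : ℝ) : ℝ :=
  if w ∈ dyadicGrid l ∧ b ∈ dyadicGrid l then tridiag P Q (mesh l) w b else 0

variable {P Q}

lemma tridiag_symm {h : ℝ} (hh : 0 < h) (w b : ℝ) : tridiag P Q h w b = tridiag P Q h b w := by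
  unfold tridiag
  by_cases h1 : w = b
  · subst h1; rfl
  by_cases h2 : w = b + h
  · subst h2
    rw [if_neg h1, if_pos rfl, if_neg (Ne.symm h1), if_neg (by linarith), if_pos (by ring)]
    simp
  by_cases h3 : w = b - h
  · subst h3
    rw [if_neg h1, if_neg h2, if_pos rfl, if_neg (Ne.symm h1), if_pos (by ring)]
    simp
  · rw [if_neg h1, if_neg h2, if_neg h3, if_neg (Ne.symm h1),
      if_neg (fun h => h3 (by linarith)), if_neg (fun h => h2 (by linarith))]

lemma markovInv_symm (l : ℕ) (w b : ℝ) : markovInv P Q l w b = markovInv P Q l b w := by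
  unfold markovInv
  simp only [tridiag_symm (mesh_pos l) w b, and_comm]

lemma sum_markovInv (hP : P 0 = 0) (hQ : Q 1 = 0) {l : ℕ} {a b : ℝ}
    (ha : a ∈ Set.Ioo (0 : ℝ) 1) (hb : b ∈ dyadicGrid l) :
    ∑ w ∈ dyadicGrid l, P (min a w) * Q (max a w) * markovInv P Q l w b =
      P (min a (b - mesh l)) * Q (max a (b - mesh l)) * (-1 / wron P Q b (b - mesh l)) +
      P (min a b) * Q (max a b) * (wron P Q (b + mesh l) (b - mesh l) /
        (wron P Q b (b - mesh l) * wron P Q (b + mesh l) b)) +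
      P (min a (b + mesh l)) * Q (max a (b + mesh l)) * (-1 / wron P Q (b + mesh l) b) := by
  classical
  have hm := mesh_pos l
  set f : ℝ → ℝ := fun w => P (min a w) * Q (max a w) * tridiag P Q (mesh l) w b with hf
  have e1 : ∑ w ∈ dyadicGrid l, P (min a w) * Q (max a w) * markovInv P Q l w b =
      ∑ w ∈ dyadicGrid l, f w := by
    refine Finset.sum_congr rfl fun w hw => ?_
    simp only [hf, markovInv, if_pos (And.intro hw hb)]
  have e2 : ∑ w ∈ dyadicGrid l, f w = ∑ w ∈ dyadicGrid l ∪ nbrs l b, f w := by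
    refine Finset.sum_subset Finset.subset_union_left fun w hw hw' => ?_
    rcases Finset.mem_union.1 hw with h | h
    · exact absurd h hw'
    simp only [nbrs, Finset.mem_insert, Finset.mem_singleton] at h
    rcases h with rfl | rfl | rfl
    · rcases dyadicGrid_pred hb with h | h
      · simp [hf, h, min_eq_right ha.1.le, hP]
      · exact absurd h hw'
    · exact absurd hb hw'
    · rcases dyadicGrid_succ hb with h | h
      · simp [hf, h, max_eq_right ha.2.le, hQ]
      · exact absurd h hw'
  have e3 : ∑ w ∈ nbrs l b, f w = ∑ w ∈ dyadicGrid l ∪ nbrs l b, f w := by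
    refine Finset.sum_subset Finset.subset_union_right fun w _ hw' => ?_
    simp only [nbrs, Finset.mem_insert, Finset.mem_singleton, not_or] at hw'
    simp [hf, tridiag, hw'.1, hw'.2.1, hw'.2.2]
  rw [e1, e2, ← e3, nbrs, Finset.sum_insert, Finset.sum_insert, Finset.sum_singleton]
  · have t1 : tridiag P Q (mesh l) (b - mesh l) b = -1 / wron P Q b (b - mesh l) := by
      unfold tridiag
      rw [if_neg (by linarith), if_neg (by linarith), if_pos rfl]
    have t2 : tridiag P Q (mesh l) b b = wron P Q (b + mesh l) (b - mesh l) /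
        (wron P Q b (b - mesh l) * wron P Q (b + mesh l) b) := by
      unfold tridiag
      rw [if_pos rfl]
    have t3 : tridiag P Q (mesh l) (b + mesh l) b = -1 / wron P Q (b + mesh l) b := by
      unfold tridiag
      rw [if_neg (by linarith), if_pos rfl]
    simp only [hf, t1, t2, t3]
    ring
  · simp; linarith
  · simp only [Finset.mem_insert, Finset.mem_singleton, not_or]
    constructor <;> linarith

lemma wron_pos_of_mem
    (hW : ∀ y ∈ Set.Icc (0 : ℝ) 1, ∀ x ∈ Set.Icc (0 : ℝ) 1, y < x → 0 < wron P Q x y)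
    {l : ℕ} {b : ℝ} (hb : b ∈ dyadicGrid l) :
    0 < wron P Q b (b - mesh l) ∧ 0 < wron P Q (b + mesh l) b := by
  have hm := mesh_pos l
  have hb' := dyadicGrid_subset_Ioo hb
  have h0 : 0 ≤ b - mesh l := by
    rcases dyadicGrid_pred hb with h | h
    · exact h.ge
    · exact (dyadicGrid_subset_Ioo h).1.le
  have h1 : b + mesh l ≤ 1 := by
    rcases dyadicGrid_succ hb with h | h
    · exact h.le
    · exact (dyadicGrid_subset_Ioo h).2.le
  exact ⟨hW _ ⟨h0, by linarith [hb'.2]⟩ _ ⟨hb'.1.le, hb'.2.le⟩ (by linarith),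
    hW _ ⟨hb'.1.le, hb'.2.le⟩ _ ⟨by linarith [hb'.1], h1⟩ (by linarith)⟩

lemma sum_markovInv_eq_zero (hP : P 0 = 0) (hQ : Q 1 = 0)
    (hW : ∀ y ∈ Set.Icc (0 : ℝ) 1, ∀ x ∈ Set.Icc (0 : ℝ) 1, y < x → 0 < wron P Q x y)
    {l : ℕ} {a b : ℝ} (ha : a ∈ Set.Ioo (0 : ℝ) 1) (hb : b ∈ dyadicGrid l)
    (hab : a ≤ b - mesh l ∨ b + mesh l ≤ a) :
    ∑ w ∈ dyadicGrid l, P (min a w) * Q (max a w) * markovInv P Q l w b = 0 := by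
  have hm := mesh_pos l
  rw [sum_markovInv hP hQ ha hb]
  obtain ⟨w1, w2⟩ := wron_pos_of_mem hW hb
  have w1' := w1.ne'
  have w2' := w2.ne'
  rcases hab with h | h
  · rw [min_eq_left h, max_eq_right h, min_eq_left (by linarith), max_eq_right (by linarith),
      min_eq_left (by linarith), max_eq_right (by linarith)]
    field_simp
    unfold wron
    ring
  · rw [min_eq_right h, max_eq_left h, min_eq_right (by linarith), max_eq_left (by linarith),
      min_eq_right (by linarith), max_eq_left (by linarith)]
    field_simp
    unfold wron
    ring

lemma sum_markovInv_self (hP : P 0 = 0) (hQ : Q 1 = 0)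
    (hW : ∀ y ∈ Set.Icc (0 : ℝ) 1, ∀ x ∈ Set.Icc (0 : ℝ) 1, y < x → 0 < wron P Q x y)
    {l : ℕ} {b : ℝ} (hb : b ∈ dyadicGrid l) :
    ∑ w ∈ dyadicGrid l, P (min b w) * Q (max b w) * markovInv P Q l w b = 1 := by
  have hm := mesh_pos l
  rw [sum_markovInv hP hQ (dyadicGrid_subset_Ioo hb) hb]
  obtain ⟨w1, w2⟩ := wron_pos_of_mem hW hb
  have w1' := w1.ne'
  have w2' := w2.ne'
  rw [min_self, max_self, min_eq_right (by linarith), max_eq_left (by linarith),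
      min_eq_left (by linarith), max_eq_right (by linarith)]
  field_simp
  unfold wron
  ring

/-- Sparse dyadic inverses of a Markov kernel vanishing on the boundary. -/
noncomputable def DyadicInverse.ofMarkov (hP : P 0 = 0) (hQ : Q 1 = 0)
    (hW : ∀ y ∈ Set.Icc (0 : ℝ) 1, ∀ x ∈ Set.Icc (0 : ℝ) 1, y < x → 0 < wron P Q x y) :
    DyadicInverse (fun a b => P (min a b) * Q (max a b)) where
  T := markovInv P Q
  mem_left := by
    intro l w b h
    by_contra hc
    exact h (if_neg fun hh => hc hh.1)
  mem_right := by
    intro l w b h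
    by_contra hc
    exact h (if_neg fun hh => hc hh.2)
  mem_nbrs := by
    intro l w b h
    by_contra hc
    refine h ?_
    simp only [nbrs, Finset.mem_insert, Finset.mem_singleton, not_or] at hc
    simp [markovInv, tridiag, hc.1, hc.2.1, hc.2.2]
  mul_eq := by
    intro l a ha b
    by_cases hb : b ∈ dyadicGrid l
    · split_ifs with hab
      · subst hab
        exact sum_markovInv_self hP hQ hW hb
      · refine sum_markovInv_eq_zero hP hQ hW (dyadicGrid_subset_Ioo ha) hb ?_
        rcases lt_or_gt_of_ne hab with h | h
        · left; linarith [dyadicGrid_gap ha hb h]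
        · right; exact dyadicGrid_gap hb ha h
    · have hab : a ≠ b := fun h => hb (h ▸ ha)
      rw [if_neg hab]
      refine Finset.sum_eq_zero fun w _ => ?_
      rw [markovInv, if_neg fun h => hb h.2, mul_zero]
  apply_near := by
    intro z hz l w h
    have hw : w ∈ dyadicGrid l := by
      by_contra hc
      refine h (Finset.sum_eq_zero fun b _ => ?_)
      rw [markovInv, if_neg fun h => hc h.1, zero_mul]
    by_contra hc
    refine h ?_
    rw [← sum_markovInv_eq_zero hP hQ hW hz hw]
    · refine Finset.sum_congr rfl fun b _ => ?_
      rw [markovInv_symm, mul_comm]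
    · by_contra! hh
      exact hc (mem_nearPts hz.1.le hw hh.1 hh.2)

end OneDim

/-- Transport of sparse dyadic inverses along equality of kernels on `(0,1)`. -/
def DyadicInverse.congr {k k' : ℝ → ℝ → ℝ} (D : DyadicInverse k)
    (h : ∀ a ∈ Set.Ioo (0 : ℝ) 1, ∀ b ∈ Set.Ioo (0 : ℝ) 1, k a b = k' a b) :
    DyadicInverse k' where
  T := D.T
  mem_left := D.mem_left
  mem_right := D.mem_right
  mem_nbrs := D.mem_nbrs
  mul_eq := by
    intro l a ha b
    rw [← D.mul_eq ha b]
    refine Finset.sum_congr rfl fun w hw => ?_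
    rw [h _ (dyadicGrid_subset_Ioo ha) _ (dyadicGrid_subset_Ioo hw)]
  apply_near := by
    intro z hz l w hne
    refine D.apply_near hz (l := l) ?_
    convert hne using 1
    refine Finset.sum_congr rfl fun b hb => ?_
    rw [h _ hz _ (dyadicGrid_subset_Ioo hb)]

/-- Every one-dimensional factor of a TM kernel has sparse dyadic inverses. -/
noncomputable def TMKernelSL.dyadicInverse {d : ℕ} (κ : TMKernelSL d) (j : Fin d) :
    DyadicInverse (κ.k1 j) := by
  let P : ℝ → ℝ := fun x => if x ≤ 0 then 0 else if 1 ≤ x then 1 else κ.p j x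
  let Q : ℝ → ℝ := fun x => if x ≤ 0 then 1 else if 1 ≤ x then 0 else κ.q j x
  have hP : ∀ x ∈ Set.Ioo (0 : ℝ) 1, P x = κ.p j x := fun x hx => by
    simp only [P, if_neg (not_le.2 hx.1), if_neg (not_le.2 hx.2)]
  have hQ : ∀ x ∈ Set.Ioo (0 : ℝ) 1, Q x = κ.q j x := fun x hx => by
    simp only [Q, if_neg (not_le.2 hx.1), if_neg (not_le.2 hx.2)]
  refine (DyadicInverse.ofMarkov (P := P) (Q := Q) (by simp [P]) (by simp [Q]) ?_).congr ?_
  · intro y hy x hx hyx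
    have P0 : P 0 = 0 := by simp [P]
    have Q0 : Q 0 = 1 := by simp [Q]
    have P1 : P 1 = 1 := by simp [P]
    have Q1 : Q 1 = 0 := by simp [Q]
    unfold wron
    rcases hy.1.eq_or_lt with rfl | hy0
    · rcases hx.2.eq_or_lt with rfl | hx1
      · simp [P0, Q0, P1, Q1]
      · simpa [P0, Q0, hP x ⟨hyx, hx1⟩] using κ.pos_p j x ⟨hyx, hx1⟩
    · have hy' : y ∈ Set.Ioo (0 : ℝ) 1 := ⟨hy0, hyx.trans_le hx.2⟩
      rcases hx.2.eq_or_lt with rfl | hx1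
      · simpa [P1, Q1, hQ y hy'] using κ.pos_q j y hy'
      · have hx' : x ∈ Set.Ioo (0 : ℝ) 1 := ⟨hy0.trans hyx, hx1⟩
        rw [hP x hx', hP y hy', hQ x hx', hQ y hy']
        exact κ.det_pos j y hy x hx hyx
  · intro a ha b hb
    simp only [TMKernelSL.k1]
    rw [hP _ ⟨lt_min ha.1 hb.1, (min_le_left _ _).trans_lt ha.2⟩,
      hQ _ ⟨ha.1.trans_le (le_max_left _ _), max_lt ha.2 hb.2⟩]

lemma sum_Icc_sub_pred (f : ℕ → ℝ) (n : ℕ) :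
    ∑ l ∈ Finset.Icc 1 n, (f l - f (l - 1)) = f n - f 0 := by
  induction n with
  | zero => simp
  | succ n ih => rw [Finset.sum_Icc_succ_top (by omega), ih, Nat.add_sub_cancel]; ring

namespace DyadicInverse

variable {k : ℝ → ℝ → ℝ} (D : DyadicInverse k)

lemma T_zero (w b : ℝ) : D.T 0 w b = 0 := by
  by_contra h
  simpa [dyadicGrid_zero] using D.mem_left h

/-- The difference of the inverses on two consecutive levels. -/
def diff (l : ℕ) (w b : ℝ) : ℝ := D.T l w b - D.T (l - 1) w b

lemma diff_ne_zero {l : ℕ} {w b : ℝ} (h : D.diff l w b ≠ 0) :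
    w ∈ dyadicGrid l ∧ b ∈ dyadicGrid l ∧ w ∈ nbrs l b ∪ nbrs (l - 1) b := by
  have hs : dyadicGrid (l - 1) ⊆ dyadicGrid l := dyadicGrid_mono (Nat.sub_le l 1)
  by_cases h1 : D.T l w b = 0
  · have h2 : D.T (l - 1) w b ≠ 0 := fun h2 => h (by simp [diff, h1, h2])
    exact ⟨hs (D.mem_left h2), hs (D.mem_right h2), Finset.mem_union_right _ (D.mem_nbrs h2)⟩
  · exact ⟨D.mem_left h1, D.mem_right h1, Finset.mem_union_left _ (D.mem_nbrs h1)⟩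

/-- The kernel matrix applied to a column of the inverse on the grid of level `l`. -/
noncomputable def colProd (l : ℕ) (a b : ℝ) : ℝ := ∑ w ∈ dyadicGrid l, k a w * D.T l w b

/-- The inverse on the grid of level `l` applied to the kernel vector of `z`. -/
noncomputable def weight (z : ℝ) (l : ℕ) (w : ℝ) : ℝ := ∑ b ∈ dyadicGrid l, D.T l w b * k z b

lemma weight_zero (z w : ℝ) : D.weight z 0 w = 0 := by simp [weight, dyadicGrid_zero]

lemma colProd_zero (a b : ℝ) : D.colProd 0 a b = 0 := by simp [colProd, dyadicGrid_zero]

lemma sum_mul_diff (l : ℕ) (a b : ℝ) :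
    ∑ w ∈ dyadicGrid l, k a w * D.diff l w b = D.colProd l a b - D.colProd (l - 1) a b := by
  have hs : dyadicGrid (l - 1) ⊆ dyadicGrid l := dyadicGrid_mono (Nat.sub_le l 1)
  have e : D.colProd (l - 1) a b = ∑ w ∈ dyadicGrid l, k a w * D.T (l - 1) w b := by
    refine Finset.sum_subset hs fun w _ hw => ?_
    by_contra h
    exact hw (D.mem_left (right_ne_zero_of_mul h))
  rw [e, colProd, ← Finset.sum_sub_distrib]
  exact Finset.sum_congr rfl fun w _ => by rw [diff]; ring

lemma sum_diff_mul (l : ℕ) (z w : ℝ) :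
    ∑ b ∈ dyadicGrid l, D.diff l w b * k z b = D.weight z l w - D.weight z (l - 1) w := by
  have hs : dyadicGrid (l - 1) ⊆ dyadicGrid l := dyadicGrid_mono (Nat.sub_le l 1)
  have e : D.weight z (l - 1) w = ∑ b ∈ dyadicGrid l, D.T (l - 1) w b * k z b := by
    refine Finset.sum_subset hs fun b _ hb => ?_
    by_contra h
    exact hb (D.mem_right (left_ne_zero_of_mul h))
  rw [e, weight, ← Finset.sum_sub_distrib]
  exact Finset.sum_congr rfl fun w _ => by rw [diff]; ring

end DyadicInverse

/-- The level multi-indices of a sparse grid. -/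
def levelSet (d N : ℕ) : Finset (Fin d → ℕ) :=
  {l ∈ Fintype.piFinset (fun _ => Finset.Icc 1 N) | ∑ j, l j ≤ N}

lemma mem_levelSet {d N : ℕ} {l : Fin d → ℕ} :
    l ∈ levelSet d N ↔ (∀ j, 1 ≤ l j) ∧ ∑ j, l j ≤ N := by
  simp only [levelSet, Finset.mem_filter, Fintype.mem_piFinset, Finset.mem_Icc]
  refine ⟨fun h => ⟨fun j => (h.1 j).1, h.2⟩, fun h => ⟨fun j => ⟨h.1 j, ?_⟩, h.2⟩⟩
  exact (Finset.single_le_sum (fun i _ => Nat.zero_le (l i)) (Finset.mem_univ j)).trans h.2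

/-- The finite full grid with levels `l`. -/
noncomputable def fullGrid {d : ℕ} (l : Fin d → ℕ) : Finset (Fin d → ℝ) :=
  Fintype.piFinset fun j => dyadicGrid (l j)

lemma mem_fullGrid {d : ℕ} {l : Fin d → ℕ} {x : Fin d → ℝ} :
    x ∈ fullGrid l ↔ ∀ j, x j ∈ dyadicGrid (l j) := Fintype.mem_piFinset

lemma mem_SGset {d τ : ℕ} {x : Fin d → ℝ} :
    x ∈ SGset d τ ↔ ∃ l ∈ levelSet d (τ + d - 1), x ∈ fullGrid l := by
  simp only [SGset, Set.mem_ofPred_eq, mem_levelSet, mem_fullGrid, mem_dyadicGrid, and_assoc]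

lemma sum_levelSet_succ (n N : ℕ) (f : (Fin (n + 1) → ℕ) → ℝ) :
    ∑ l ∈ levelSet (n + 1) N, f l =
      ∑ l' ∈ levelSet n N, ∑ s ∈ Finset.Icc 1 (N - ∑ j, l' j), f (Fin.cons s l') := by
  rw [Finset.sum_sigma']
  refine Finset.sum_bij' (fun l _ => ⟨Fin.tail l, l 0⟩) (fun a _ => Fin.cons a.2 a.1) ?_ ?_ ?_ ?_ ?_
  · intro l hl
    rw [mem_levelSet, Fin.sum_univ_succ] at hl
    have h0 := hl.1 0
    rw [Finset.mem_sigma, mem_levelSet, Finset.mem_Icc]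
    simp only [Fin.tail]
    exact ⟨⟨fun j => hl.1 _, by omega⟩, h0, by omega⟩
  · rintro ⟨l', s⟩ h
    rw [Finset.mem_sigma, mem_levelSet, Finset.mem_Icc] at h
    dsimp only at h
    rw [mem_levelSet, Fin.sum_univ_succ]
    refine ⟨Fin.cases h.2.1 h.1.1, ?_⟩
    · simp only [Fin.cons_zero, Fin.cons_succ]
      have := h.1.2
      have := h.2.2
      omega
  · intro l _
    simp
  · rintro ⟨l', s⟩ _
    simp
  · intro l _
    simp

section Tensor

variable {d : ℕ} {k : Fin d → ℝ → ℝ → ℝ} (D : ∀ j, DyadicInverse (k j))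

/-- The inverse of the tensor product kernel on a sparse grid. -/
def sparseInv (N : ℕ) (w b : Fin d → ℝ) : ℝ :=
  ∑ l ∈ levelSet d N, ∏ j, (D j).diff (l j) (w j) (b j)

lemma sum_mul_sparseInv {N : ℕ} {G : Finset (Fin d → ℝ)}
    (hG : ∀ x, x ∈ G ↔ ∃ l ∈ levelSet d N, x ∈ fullGrid l) {a : Fin d → ℝ} (ha : a ∈ G)
    (b : Fin d → ℝ) :
    ∑ w ∈ G, (∏ j, k j (a j) (w j)) * sparseInv D N w b = if a = b then 1 else 0 := by
  classical
  obtain ⟨m, hm, hma⟩ := (hG a).1 ha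
  rw [mem_fullGrid] at hma
  rw [mem_levelSet] at hm
  have step : ∀ l ∈ levelSet d N,
      ∑ w ∈ G, (∏ j, k j (a j) (w j)) * ∏ j, (D j).diff (l j) (w j) (b j) =
      ∏ j, ((D j).colProd (l j) (a j) (b j) - (D j).colProd (l j - 1) (a j) (b j)) := by
    intro l hl
    simp only [← (D _).sum_mul_diff, ← Finset.prod_mul_distrib]
    rw [Finset.prod_univ_sum]
    symm
    refine Finset.sum_subset (fun w hw => (hG w).2 ⟨l, hl, hw⟩) fun w _ hw => ?_
    rw [Fintype.mem_piFinset] at hw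
    push Not at hw
    obtain ⟨j, hj⟩ := hw
    refine Finset.prod_eq_zero (Finset.mem_univ j) ?_
    by_contra h
    exact hj ((D j).diff_ne_zero (right_ne_zero_of_mul h)).1
  simp only [sparseInv, Finset.mul_sum]
  rw [Finset.sum_comm, Finset.sum_congr rfl step]
  have hsub : Fintype.piFinset (fun j => Finset.Icc 1 (m j)) ⊆ levelSet d N := by
    intro l hl
    simp only [Fintype.mem_piFinset, Finset.mem_Icc] at hl
    exact mem_levelSet.2 ⟨fun j => (hl j).1, (Finset.sum_le_sum fun j _ => (hl j).2).trans hm.2⟩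
  rw [← Finset.sum_subset hsub, ← Finset.prod_univ_sum (fun j => Finset.Icc 1 (m j))
    (fun j s => (D j).colProd s (a j) (b j) - (D j).colProd (s - 1) (a j) (b j))]
  · have e : ∀ j, ∑ s ∈ Finset.Icc 1 (m j),
        ((D j).colProd s (a j) (b j) - (D j).colProd (s - 1) (a j) (b j)) =
        if a j = b j then 1 else 0 := by
      intro j
      rw [sum_Icc_sub_pred (fun s => (D j).colProd s (a j) (b j)), (D j).colProd_zero, sub_zero]
      exact (D j).mul_eq (hma j) (b j)
    simp only [e]
    split_ifs with hab
    · simp [hab]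
    · obtain ⟨j, hj⟩ := Function.ne_iff.1 hab
      exact Finset.prod_eq_zero (Finset.mem_univ j) (if_neg hj)
  · intro l hl hl'
    rw [Fintype.mem_piFinset] at hl'
    push Not at hl'
    obtain ⟨j, hj⟩ := hl'
    have h1 := (mem_levelSet.1 hl).1 j
    have h2 : m j ≤ l j - 1 := by
      rw [Finset.mem_Icc] at hj
      omega
    refine Finset.prod_eq_zero (Finset.mem_univ j) ?_
    have a1 := (D j).mul_eq (dyadicGrid_mono h2 (hma j)) (b j)
    have a2 := (D j).mul_eq (dyadicGrid_mono (h2.trans (Nat.sub_le _ 1)) (hma j)) (b j)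
    simp only [DyadicInverse.colProd, a1, a2, sub_self]

lemma sum_sparseInv_mul {N : ℕ} {G : Finset (Fin d → ℝ)}
    (hG : ∀ x, x ∈ G ↔ ∃ l ∈ levelSet d N, x ∈ fullGrid l) (z w : Fin d → ℝ) :
    ∑ b ∈ G, sparseInv D N w b * ∏ j, k j (z j) (b j) =
      ∑ l ∈ levelSet d N,
        ∏ j, ((D j).weight (z j) (l j) (w j) - (D j).weight (z j) (l j - 1) (w j)) := by
  classical
  simp only [sparseInv, Finset.sum_mul]
  rw [Finset.sum_comm]
  refine Finset.sum_congr rfl fun l hl => ?_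
  simp only [← (D _).sum_diff_mul, ← Finset.prod_mul_distrib]
  rw [Finset.prod_univ_sum]
  symm
  refine Finset.sum_subset (fun w hw => (hG w).2 ⟨l, hl, hw⟩) fun b _ hb => ?_
  rw [Fintype.mem_piFinset] at hb
  push Not at hb
  obtain ⟨j, hj⟩ := hb
  refine Finset.prod_eq_zero (Finset.mem_univ j) ?_
  by_contra h
  exact hj ((D j).diff_ne_zero (left_ne_zero_of_mul h)).2.1

end Tensor

lemma sum_two_pow_le_card {d N : ℕ} {G : Finset (Fin d → ℝ)}
    (hG : ∀ x, x ∈ G ↔ ∃ l ∈ levelSet d N, x ∈ fullGrid l) :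
    ∑ l ∈ levelSet d N, ∏ j, 2 ^ (l j - 1) ≤ G.card := by
  classical
  let Y : (Fin d → ℕ) → Finset (Fin d → ℝ) := fun l =>
    Fintype.piFinset fun j => dyadicGrid (l j) \ dyadicGrid (l j - 1)
  have hY : ∀ l ∈ levelSet d N, (Y l).card = ∏ j, 2 ^ (l j - 1) := by
    intro l hl
    rw [Fintype.card_piFinset]
    refine Finset.prod_congr rfl fun j _ => ?_
    have h1 := (mem_levelSet.1 hl).1 j
    rw [Finset.card_sdiff_of_subset (dyadicGrid_mono (Nat.sub_le _ 1)), card_dyadicGrid,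
      card_dyadicGrid]
    obtain ⟨s, hs⟩ : ∃ s, l j = s + 1 := ⟨l j - 1, by omega⟩
    have := Nat.one_le_two_pow (n := s)
    rw [hs, pow_succ, Nat.add_sub_cancel]
    omega
  rw [← Finset.sum_congr rfl hY, ← Finset.card_biUnion]
  · refine Finset.card_le_card fun x hx => ?_
    obtain ⟨l, hl, hx⟩ := Finset.mem_biUnion.1 hx
    refine (hG x).2 ⟨l, hl, mem_fullGrid.2 fun j => ?_⟩
    exact (Finset.mem_sdiff.1 (Fintype.mem_piFinset.1 hx j)).1
  · intro l _ l' _ hne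
    refine Finset.disjoint_left.2 fun {x} hx hx' => ?_
    obtain ⟨j, hj⟩ := Function.ne_iff.1 hne
    have h1 := Finset.mem_sdiff.1 (Fintype.mem_piFinset.1 hx j)
    have h2 := Finset.mem_sdiff.1 (Fintype.mem_piFinset.1 hx' j)
    rcases lt_or_gt_of_ne hj with h | h
    · exact h2.2 (dyadicGrid_mono (by omega) h1.1)
    · exact h1.2 (dyadicGrid_mono (by omega) h2.1)

lemma card_nbrs_union_le (l : ℕ) (b : ℝ) : (nbrs l b ∪ nbrs (l - 1) b).card ≤ 6 := by
  refine (Finset.card_union_le _ _).trans ?_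
  have h1 : (nbrs l b).card ≤ 3 := Finset.card_le_three
  have h2 : (nbrs (l - 1) b).card ≤ 3 := Finset.card_le_three
  omega

lemma card_nearPts_le (l : ℕ) (z : ℝ) : (nearPts l z).card ≤ 2 := Finset.card_le_two

lemma nnz_sparseInv_le {d N : ℕ} {k : Fin d → ℝ → ℝ → ℝ} (D : ∀ j, DyadicInverse (k j))
    {G : Finset (Fin d → ℝ)} (hG : ∀ x, x ∈ G ↔ ∃ l ∈ levelSet d N, x ∈ fullGrid l) :
    nnzM (Matrix.of fun a b : ↥G => sparseInv D N a b) ≤ 12 ^ d * G.card := by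
  classical
  let S : Finset ((Fin d → ℝ) × (Fin d → ℝ)) := (levelSet d N).biUnion fun l =>
    (fullGrid l).biUnion fun b =>
      (Fintype.piFinset fun j => nbrs (l j) (b j) ∪ nbrs (l j - 1) (b j)).image fun w => (w, b)
  have hS : S.card ≤ 12 ^ d * G.card := by
    refine le_trans ?_ (Nat.mul_le_mul_left _ (sum_two_pow_le_card hG))
    rw [Finset.mul_sum]
    refine Finset.card_biUnion_le.trans (Finset.sum_le_sum fun l hl => ?_)
    refine Finset.card_biUnion_le.trans ?_
    have h1 : ∀ b ∈ fullGrid l, ((Fintype.piFinset fun j =>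
        nbrs (l j) (b j) ∪ nbrs (l j - 1) (b j)).image fun w => (w, b)).card ≤ 6 ^ d := by
      intro b _
      refine Finset.card_image_le.trans ?_
      rw [Fintype.card_piFinset]
      refine (Finset.prod_le_prod' fun j _ => card_nbrs_union_le (l j) (b j)).trans ?_
      simp
    refine (Finset.sum_le_card_nsmul _ _ _ h1).trans ?_
    have h2 : (fullGrid l).card ≤ 2 ^ d * ∏ j, 2 ^ (l j - 1) := by
      rw [fullGrid, Fintype.card_piFinset]
      have : (2 : ℕ) ^ d * ∏ j, 2 ^ (l j - 1) = ∏ j, 2 * 2 ^ (l j - 1) := by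
        rw [Finset.prod_mul_distrib]; simp
      rw [this]
      refine Finset.prod_le_prod' fun j _ => ?_
      have h1 := (mem_levelSet.1 hl).1 j
      rw [card_dyadicGrid, ← pow_succ', Nat.sub_add_cancel h1]
      exact Nat.sub_le _ _
    rw [smul_eq_mul]
    refine (Nat.mul_le_mul_right _ h2).trans (le_of_eq ?_)
    rw [show 12 = 2 * 6 from rfl, mul_pow]
    ring
  refine le_trans ?_ hS
  rw [nnzM, ← Set.ncard_coe_finset]
  refine Set.ncard_le_ncard_of_injOn (fun ab => ((ab.1 : Fin d → ℝ), (ab.2 : Fin d → ℝ))) ?_ ?_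
    (Finset.finite_toSet S)
  · rintro ⟨w, b⟩ h
    simp only [Set.mem_ofPred_eq, Matrix.of_apply, sparseInv] at h
    obtain ⟨l, hl, hne⟩ := Finset.exists_ne_zero_of_sum_ne_zero h
    rw [Finset.prod_ne_zero_iff] at hne
    have hj := fun j => (D j).diff_ne_zero (hne j (Finset.mem_univ j))
    simp only [S, Finset.mem_coe, Finset.mem_biUnion, Finset.mem_image]
    exact ⟨l, hl, b, mem_fullGrid.2 fun j => (hj j).2.1, w,
      Fintype.mem_piFinset.2 fun j => (hj j).2.2, rfl⟩
  · rintro ⟨w, b⟩ _ ⟨w', b'⟩ _ h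
    simp only [Prod.mk.injEq] at h
    exact Prod.ext (Subtype.ext h.1) (Subtype.ext h.2)

lemma weightSum_ne_zero {n N : ℕ} {k : Fin (n + 1) → ℝ → ℝ → ℝ} (D : ∀ j, DyadicInverse (k j))
    {z w : Fin (n + 1) → ℝ} (hz : ∀ j, z j ∈ Set.Ioo (0 : ℝ) 1)
    (h : ∑ l ∈ levelSet (n + 1) N,
      ∏ j, ((D j).weight (z j) (l j) (w j) - (D j).weight (z j) (l j - 1) (w j)) ≠ 0) :
    ∃ l' ∈ levelSet n N, w 0 ∈ nearPts (N - ∑ j, l' j) (z 0) ∧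
      ∀ j : Fin n, w j.succ ∈ nearPts (l' j) (z j.succ) ∪ nearPts (l' j - 1) (z j.succ) := by
  rw [sum_levelSet_succ] at h
  obtain ⟨l', hl', hne⟩ := Finset.exists_ne_zero_of_sum_ne_zero h
  simp only [Fin.prod_univ_succ, Fin.cons_zero, Fin.cons_succ] at hne
  rw [← Finset.sum_mul, sum_Icc_sub_pred (fun s => (D 0).weight (z 0) s (w 0)),
    (D 0).weight_zero, sub_zero] at hne
  refine ⟨l', hl', (D 0).apply_near (hz 0) (left_ne_zero_of_mul hne), fun j => ?_⟩
  have hj := Finset.prod_ne_zero_iff.1 (right_ne_zero_of_mul hne) j (Finset.mem_univ j)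
  by_cases h1 : (D j.succ).weight (z j.succ) (l' j) (w j.succ) = 0
  · refine Finset.mem_union_right _ ((D j.succ).apply_near (hz j.succ) fun h2 => hj ?_)
    change (D j.succ).weight (z j.succ) (l' j - 1) (w j.succ) = 0 at h2
    rw [h1, h2, sub_zero]
  · exact Finset.mem_union_left _ ((D j.succ).apply_near (hz j.succ) h1)

lemma card_weight_support_le {n N : ℕ} {k : Fin (n + 1) → ℝ → ℝ → ℝ}
    (D : ∀ j, DyadicInverse (k j)) {G : Finset (Fin (n + 1) → ℝ)}
    {z : Fin (n + 1) → ℝ} (hz : ∀ j, z j ∈ Set.Ioo (0 : ℝ) 1) :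
    Set.ncard {w : ↥G | ∑ l ∈ levelSet (n + 1) N, ∏ j, ((D j).weight (z j) (l j) (w.1 j) -
      (D j).weight (z j) (l j - 1) (w.1 j)) ≠ 0} ≤ N ^ n * 4 ^ (n + 1) := by
  classical
  let F : (Fin n → ℕ) → Fin (n + 1) → Finset ℝ := fun l' =>
    Fin.cons (nearPts (N - ∑ j, l' j) (z 0))
      (fun j => nearPts (l' j) (z j.succ) ∪ nearPts (l' j - 1) (z j.succ))
  let S : Finset (Fin (n + 1) → ℝ) := (levelSet n N).biUnion fun l' => Fintype.piFinset (F l')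
  have hS : S.card ≤ N ^ n * 4 ^ (n + 1) := by
    have h1 : ∀ l' ∈ levelSet n N, (Fintype.piFinset (F l')).card ≤ 4 ^ (n + 1) := by
      intro l' _
      rw [Fintype.card_piFinset]
      have : ∀ j, (F l' j).card ≤ 4 := by
        refine Fin.cases ?_ fun j => ?_
        · exact (card_nearPts_le _ _).trans (by norm_num)
        · exact (Finset.card_union_le _ _).trans
            (Nat.add_le_add (card_nearPts_le _ _) (card_nearPts_le _ _))
      refine (Finset.prod_le_prod' fun j _ => this j).trans ?_
      simp
    refine (Finset.card_biUnion_le.trans (Finset.sum_le_card_nsmul _ _ _ h1)).trans ?_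
    rw [smul_eq_mul]
    refine Nat.mul_le_mul_right _ ((Finset.card_filter_le _ _).trans ?_)
    simp
  refine le_trans ?_ hS
  rw [← Set.ncard_coe_finset]
  refine Set.ncard_le_ncard_of_injOn Subtype.val ?_ Subtype.val_injective.injOn
    (Finset.finite_toSet S)
  intro w hw
  obtain ⟨l', hl', h0, hj⟩ := weightSum_ne_zero D hz hw
  refine Finset.mem_coe.2 (Finset.mem_biUnion.2 ⟨l', hl', Fintype.mem_piFinset.2 ?_⟩)
  exact Fin.cases h0 hj

lemma level_le_log_card {n τ : ℕ} (hτ : 2 ≤ τ) {G : Finset (Fin (n + 1) → ℝ)}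
    (hG : ∀ x, x ∈ G ↔ ∃ l ∈ levelSet (n + 1) (τ + n), x ∈ fullGrid l) :
    (τ : ℝ) ≤ 2 / Real.log 2 * Real.log G.card := by
  have hmem : (Fin.cons τ (fun _ => 1) : Fin (n + 1) → ℕ) ∈ levelSet (n + 1) (τ + n) := by
    refine mem_levelSet.2 ⟨Fin.cases (by simp; omega) (by simp), ?_⟩
    simp [Fin.sum_univ_succ]
  have h1 : 2 ^ (τ - 1) ≤ G.card := by
    refine le_trans ?_ (sum_two_pow_le_card hG)
    refine le_trans ?_ (Finset.single_le_sum (fun _ _ => Nat.zero_le _) hmem)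
    simp [Fin.prod_univ_succ]
  have h2 : ((2 : ℝ) ^ (τ - 1)) ≤ G.card := by exact_mod_cast h1
  have h3 := Real.log_le_log (by positivity) h2
  rw [Real.log_pow, Nat.cast_sub (by omega)] at h3
  have hl : 0 < Real.log 2 := Real.log_pos (by norm_num)
  have hτ' : (2 : ℝ) ≤ τ := by exact_mod_cast hτ
  rw [div_mul_eq_mul_div, le_div_iff₀ hl]
  push_cast at h3
  nlinarith

/-- **Proposition EC.3, Ding & Zhang.** For a TM kernel satisfying Assumption SL and the
classical sparse grid design `X_τ^SG` of size `m`, the inverse kernel matrix `K⁻¹` has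
`O(m)` nonzero entries, and for every `z ∈ (0,1)^d` the vector `K⁻¹ k(z)` has
`O((log m)^{d−1})` nonzero entries. -/
theorem sparse_grid_inverse_nnz (d : ℕ) (hd : 1 ≤ d) (κ : TMKernelSL d) :
    ∃ C : ℝ, 0 < C ∧
      ∀ τ : ℕ, 2 ≤ τ → ∀ G : Finset (Fin d → ℝ), ↑G = SGset d τ →
        ∀ K : Matrix ↥G ↥G ℝ, K = Matrix.of (fun (a b : ↥G) => κ.k ↑a ↑b) →
          (nnzM K⁻¹ : ℝ) ≤ C * (G.card : ℝ) ∧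
          ∀ z : Fin d → ℝ, (∀ j, z j ∈ Set.Ioo (0:ℝ) 1) →
            (Set.ncard {a : ↥G | (K⁻¹ *ᵥ fun b : ↥G => κ.k z ↑b) a ≠ 0} : ℝ)
              ≤ C * Real.log G.card ^ (d - 1) := by
  classical
  obtain ⟨n, rfl⟩ : ∃ n, d = n + 1 := ⟨d - 1, by omega⟩
  let D := κ.dyadicInverse
  refine ⟨12 ^ (n + 1) + 4 ^ (n + 1) * ((n + 1) * (2 / Real.log 2)) ^ n, ?_, ?_⟩
  · have hl : 0 < Real.log 2 := Real.log_pos (by norm_num)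
    positivity
  intro τ hτ G hG' K hK
  have hl : 0 < Real.log 2 := Real.log_pos (by norm_num)
  have hG : ∀ x, x ∈ G ↔ ∃ l ∈ levelSet (n + 1) (τ + n), x ∈ fullGrid l := by
    intro x
    rw [← Finset.mem_coe, hG', mem_SGset]
    rfl
  have hinv : K⁻¹ = Matrix.of fun a b : ↥G => sparseInv D (τ + n) a b := by
    refine Matrix.inv_eq_right_inv ?_
    ext a b
    rw [hK, Matrix.mul_apply, Matrix.one_apply]
    simp only [Matrix.of_apply, Subtype.ext_iff]
    rw [← sum_mul_sparseInv D hG a.2 b.1]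
    exact Finset.sum_coe_sort G fun w => κ.k a w * sparseInv D (τ + n) w b
  have hlog : 0 ≤ Real.log G.card := Real.log_natCast_nonneg _
  refine ⟨?_, fun z hz => ?_⟩
  · have h := nnz_sparseInv_le D hG
    rw [hinv]
    calc (nnzM (Matrix.of fun a b : ↥G => sparseInv D (τ + n) a b) : ℝ)
        ≤ 12 ^ (n + 1) * (G.card : ℝ) := by exact_mod_cast h
      _ ≤ _ := by
        refine mul_le_mul_of_nonneg_right (le_add_of_nonneg_right ?_) (Nat.cast_nonneg _)
        positivity
  · have hvec : ∀ w : ↥G, (K⁻¹ *ᵥ fun b : ↥G => κ.k z ↑b) w =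
        ∑ l ∈ levelSet (n + 1) (τ + n), ∏ j, ((D j).weight (z j) (l j) (w.1 j) -
          (D j).weight (z j) (l j - 1) (w.1 j)) := by
      intro w
      rw [← sum_sparseInv_mul D hG z w.1, hinv]
      exact Finset.sum_coe_sort G fun b => sparseInv D (τ + n) w b * κ.k z b
    simp only [hvec, Nat.add_sub_cancel]
    have h := card_weight_support_le (N := τ + n) D (G := G) hz
    have hτn : ((τ + n : ℕ) : ℝ) ≤ (n + 1) * (2 / Real.log 2) * Real.log G.card := by
      have h1 := level_le_log_card hτ hG
      have h2 : ((τ + n : ℕ) : ℝ) ≤ (n + 1) * τ := by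
        have : τ + n ≤ (n + 1) * τ := by nlinarith
        exact_mod_cast this
      rw [mul_assoc]
      exact h2.trans (mul_le_mul_of_nonneg_left h1 (by positivity))
    calc _ ≤ (((τ + n) ^ n * 4 ^ (n + 1) : ℕ) : ℝ) := by exact_mod_cast h
      _ = ((τ + n : ℕ) : ℝ) ^ n * 4 ^ (n + 1) := by push_cast; ring
      _ ≤ ((n + 1) * (2 / Real.log 2) * Real.log G.card) ^ n * 4 ^ (n + 1) := by gcongr
      _ = 4 ^ (n + 1) * ((n + 1) * (2 / Real.log 2)) ^ n * Real.log G.card ^ n := by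
        rw [mul_pow]; ring
      _ ≤ _ := by
        refine mul_le_mul_of_nonneg_right (le_add_of_nonneg_left ?_) (by positivity)
        positivity
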